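/- arXiv:2203.03602 — 6 statements merged into one kernel-verified Lean document; each statement's English description precedes it below -/
import Mathlib

section
/- Let λ, μ, c > 0 and θ ∈ [0,1] with θ(c + λ) < (1 − θ)μ. Then the function s ↦ (μλ/(μ+λ)) · (θc + (1−θ)s)/(μc + λs + cs) is strictly increasing on (0, ∞). -/
theorem stmt_3 (lam mu c θ : ℝ) (hlam : 0 < lam) (hmu : 0 < mu) (hc : 0 < c)
    (hθ0 : 0 ≤ θ) (hθ1 : θ ≤ 1) (hcond : θ * (c + lam) < (1 - θ) * mu) :
    StrictMonoOn (fun s : ℝ => (mu * lam / (mu + lam)) * ((θ * c + (1 - θ) * s) / (mu * c + lam * s + c * s))) (Set.Ioi 0) := by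

  intro a ha b hb hab
  have ha' : 0 < a := ha
  have hb' : 0 < b := hb
  have hk : 0 < mu * lam / (mu + lam) := by positivity
  refine mul_lt_mul_of_pos_left ?_ hk
  rw [div_lt_div_iff₀ (by positivity) (by positivity)]
  have h := mul_pos (mul_pos (sub_pos.2 hab) hc) (sub_pos.2 hcond)
  linarith [h]
end

section
/- Let λ, μ, c, β > 0 and θ ∈ [0,1] be such that θ(c + λ) ≥ (1 − θ)μ and (1/(μc)) · (λ/(μ+λ)) · (θ(c+λ) − (1−θ)μ) ≥ β. Define s = (μc/(λ+c)) · ( √( (1/(μc)) · (λ/(μ+λ)) · (θ(c+λ) − (1−θ)μ) / β ) − 1 ). Then s ≥ 0 and (μc + λs + sc)² = (μλc/(μ+λ)) · (θ(c+λ) − (1−θ)μ)/β; that is, s satisfies the KKT stationarity equation for the test-rate optimization problem. -/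
theorem stmt_6 (lam mu c β θ : ℝ) (hlam : 0 < lam) (hmu : 0 < mu) (hc : 0 < c) (hβ : 0 < β)
    (hθ0 : 0 ≤ θ) (hθ1 : θ ≤ 1)
    (hcond : θ * (c + lam) ≥ (1 - θ) * mu)
    (hbig : (1 / (mu * c)) * (lam / (mu + lam)) * (θ * (c + lam) - (1 - θ) * mu) ≥ β)
    (s : ℝ)
    (hsdef : s = (mu * c / (lam + c)) *
      (Real.sqrt ((1 / (mu * c)) * (lam / (mu + lam)) * (θ * (c + lam) - (1 - θ) * mu) / β) - 1)) :
    s ≥ 0 ∧ (mu * c + lam * s + s * c) ^ 2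
      = (mu * lam * c / (mu + lam)) * ((θ * (c + lam) - (1 - θ) * mu) / β) := by
  have h1 : 1 ≤ (1 / (mu * c)) * (lam / (mu + lam)) * (θ * (c + lam) - (1 - θ) * mu) / β := by
    rw [le_div_iff₀ hβ]; linarith
  generalize hD : θ * (c + lam) - (1 - θ) * mu = D at *
  generalize hX : (1 / (mu * c)) * (lam / (mu + lam)) * D / β = X at *
  have hr : 1 ≤ Real.sqrt X := Real.one_le_sqrt.mpr h1
  have hq : Real.sqrt X ^ 2 = X := Real.sq_sqrt (by linarith)
  constructor
  · rw [hsdef]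
    exact mul_nonneg (by positivity) (by linarith)
  · have h2 : mu * c + lam * s + s * c = mu * c * Real.sqrt X := by
      rw [hsdef]; field_simp; ring
    rw [h2, mul_pow, hq, ← hX]
    field_simp
end

section
/- Let λ, μ, s, c > 0 and set D = μc + λs + cs. Define π₀₁ = (μλ/(μ+λ)) · s/D, π₁₀ = (μλ/(μ+λ)) · c/D, π₀₀ = ((μ+s)/λ) · π₁₀, and π₁₁ = ((c+λ)/μ) · π₀₁. Then all four numbers are nonnegative, they sum to 1, and they satisfy the local balance equations π₀₀λ = π₁₀μ + π₀₁c, π₁₀(μ+s) = π₀₀λ, π₀₁(c+λ) = π₁₁μ, and π₁₁μ = π₁₀s + π₀₁λ. -/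
theorem stmt_8 (lam mu s c : ℝ) (hlam : 0 < lam) (hmu : 0 < mu) (hs : 0 < s) (hc : 0 < c)
    (D π01 π10 π00 π11 : ℝ)
    (hD : D = mu * c + lam * s + c * s)
    (h01 : π01 = (mu * lam / (mu + lam)) * (s / D))
    (h10 : π10 = (mu * lam / (mu + lam)) * (c / D))
    (h00 : π00 = ((mu + s) / lam) * π10)
    (h11 : π11 = ((c + lam) / mu) * π01) :
    (0 ≤ π00 ∧ 0 ≤ π01 ∧ 0 ≤ π10 ∧ 0 ≤ π11)
    ∧ π00 + π01 + π10 + π11 = 1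
    ∧ π00 * lam = π10 * mu + π01 * c
    ∧ π10 * (mu + s) = π00 * lam
    ∧ π01 * (c + lam) = π11 * mu
    ∧ π11 * mu = π10 * s + π01 * lam := by
  have hDpos : 0 < D := by rw [hD]; positivity
  have hml : 0 < mu + lam := by positivity
  have p01 : 0 ≤ π01 := by rw [h01]; positivity
  have p10 : 0 ≤ π10 := by rw [h10]; positivity
  have p00 : 0 ≤ π00 := by rw [h00]; positivity
  have p11 : 0 ≤ π11 := by rw [h11]; positivity
  have e00 : π00 * lam = π10 * (mu + s) := by rw [h00]; field_simp
  have e11 : π11 * mu = π01 * (c + lam) := by rw [h11]; field_simp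
  have e : π10 * s = π01 * c := by rw [h10, h01]; ring
  refine ⟨⟨p00, p01, p10, p11⟩, ?_, ?_, e00.symm, e11.symm, ?_⟩
  · rw [h00, h11, h10, h01]
    field_simp
    rw [hD]
    ring
  · linarith
  · linarith
end

section
/- Let λ, μ > 0 and p, q ∈ [0, 1/2) with p + q < 1. Then the function v ↦ Δᵉ(v) = (pμ² + qλ² + (2−p−q)μλ + v(pμ + qλ))/((λ+μ)(λ+μ+v)) is strictly convex on [0, ∞); in particular its second derivative equals 4(1−p−q)μλ/((μ+λ)(μ+λ+v)³) and is strictly positive for every v ≥ 0. -/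
theorem stmt_15 (lam mu p q : ℝ) (hlam : 0 < lam) (hmu : 0 < mu)
    (hp0 : 0 ≤ p) (hp1 : p < 1 / 2) (hq0 : 0 ≤ q) (hq1 : q < 1 / 2) (hpq : p + q < 1) :
    StrictConvexOn ℝ (Set.Ici 0) (fun v : ℝ =>
        (p * mu ^ 2 + q * lam ^ 2 + (2 - p - q) * mu * lam + v * (p * mu + q * lam))
          / ((lam + mu) * (lam + mu + v)))
    ∧ ∀ v : ℝ, 0 ≤ v →
      deriv (deriv (fun v : ℝ =>
          (p * mu ^ 2 + q * lam ^ 2 + (2 - p - q) * mu * lam + v * (p * mu + q * lam))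
            / ((lam + mu) * (lam + mu + v)))) v
        = 4 * (1 - p - q) * mu * lam / ((mu + lam) * (mu + lam + v) ^ 3)
      ∧ 0 < 4 * (1 - p - q) * mu * lam / ((mu + lam) * (mu + lam + v) ^ 3) := by
  have hc : 0 < 1 - p - q := by linarith
  have hpos : ∀ v : ℝ, 0 ≤ v →
      0 < 4 * (1 - p - q) * mu * lam / ((mu + lam) * (mu + lam + v) ^ 3) := by
    intro v hv
    positivity
  set f : ℝ → ℝ := fun v : ℝ =>
        (p * mu ^ 2 + q * lam ^ 2 + (2 - p - q) * mu * lam + v * (p * mu + q * lam))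
          / ((lam + mu) * (lam + mu + v)) with hf
  have hs : 0 < lam + mu := by positivity
  have h1 : ∀ v : ℝ, 0 < lam + mu + v →
      HasDerivAt f (-(2 * (1 - p - q) * mu * lam) / ((lam + mu) * (lam + mu + v) ^ 2)) v := by
    intro v hv
    have hn : HasDerivAt (fun v : ℝ => p * mu ^ 2 + q * lam ^ 2 + (2 - p - q) * mu * lam
        + v * (p * mu + q * lam)) (1 * (p * mu + q * lam)) v :=
      ((hasDerivAt_id v).mul_const _).const_add _
    have hd : HasDerivAt (fun v : ℝ => (lam + mu) * (lam + mu + v)) ((lam + mu) * 1) v :=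
      ((hasDerivAt_id v).const_add _).const_mul _
    have hne : (lam + mu) * (lam + mu + v) ≠ 0 := by positivity
    refine (hn.div hd hne).congr_deriv ?_
    field_simp
    ring
  have h2 : ∀ v : ℝ, 0 ≤ v → deriv (deriv f) v
      = 4 * (1 - p - q) * mu * lam / ((mu + lam) * (mu + lam + v) ^ 3) := by
    intro v hv
    have hv' : 0 < lam + mu + v := by positivity
    have hev : deriv f =ᶠ[nhds v]
        fun v => -(2 * (1 - p - q) * mu * lam) / ((lam + mu) * (lam + mu + v) ^ 2) := by
      have : ∀ᶠ x in nhds v, 0 < lam + mu + x :=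
        (by fun_prop : ContinuousAt (fun x : ℝ => lam + mu + x) v).eventually (lt_mem_nhds hv')
      filter_upwards [this] with x hx
      exact (h1 x hx).deriv
    rw [hev.deriv_eq]
    have hd : HasDerivAt (fun v : ℝ => (lam + mu) * (lam + mu + v) ^ 2)
        ((lam + mu) * (((2 : ℕ) : ℝ) * (lam + mu + v) ^ (2 - 1) * 1)) v :=
      (((hasDerivAt_id v).const_add (lam + mu)).pow 2).const_mul _
    have hne : (lam + mu) * (lam + mu + v) ^ 2 ≠ 0 := by positivity
    rw [((hasDerivAt_const v (-(2 * (1 - p - q) * mu * lam))).fun_div hd hne).deriv,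
      add_comm mu lam]
    field_simp
    push_cast
    ring
  refine ⟨?_, fun v hv => ⟨h2 v hv, hpos v hv⟩⟩
  apply strictConvexOn_of_deriv2_pos (convex_Ici 0)
  · intro x hx
    have hx' : (0 : ℝ) ≤ x := hx
    exact (h1 x (by positivity)).continuousAt.continuousWithinAt
  · intro x hx
    rw [interior_Ici] at hx
    have hx' : (0 : ℝ) ≤ x := le_of_lt hx
    change 0 < deriv (deriv f) x
    rw [h2 x hx']
    exact hpos x hx'
end

section
/- Let λ, μ > 0. Then the function w ↦ Δˢ(w) = (μλ/(μ+λ)) · (2w + μ + λ)/((w + μ + λ)(w + μ)(w + λ)) is strictly decreasing on (0, ∞). -/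
theorem stmt_18 (lam mu : ℝ) (hlam : 0 < lam) (hmu : 0 < mu) :
    StrictAntiOn (fun w : ℝ =>
        (mu * lam / (mu + lam)) * ((2 * w + mu + lam) / ((w + mu + lam) * (w + mu) * (w + lam))))
      (Set.Ioi 0) := by
  have key : ∀ w : ℝ, 0 < w → (2 * w + mu + lam) / ((w + mu + lam) * (w + mu) * (w + lam))
      = (1 / (w + mu) + 1 / (w + lam)) * (1 / (w + mu + lam)) := by
    intro w hw
    have h1 : w + mu ≠ 0 := by positivity
    have h2 : w + lam ≠ 0 := by positivity
    have h3 : w + mu + lam ≠ 0 := by positivity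
    field_simp
    ring
  intro a ha b hb hab
  have ha' : 0 < a := ha
  have hb' : 0 < b := hb
  show (mu * lam / (mu + lam)) * _ < (mu * lam / (mu + lam)) * _
  rw [key a ha', key b hb']
  have hc : 0 < mu * lam / (mu + lam) := by positivity
  apply mul_lt_mul_of_pos_left _ hc
  have e1 : 1 / (b + mu) < 1 / (a + mu) :=
    one_div_lt_one_div_of_lt (by positivity) (by linarith)
  have e2 : 1 / (b + lam) < 1 / (a + lam) :=
    one_div_lt_one_div_of_lt (by positivity) (by linarith)
  have e3 : 1 / (b + mu + lam) < 1 / (a + mu + lam) :=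
    one_div_lt_one_div_of_lt (by positivity) (by linarith)
  exact mul_lt_mul (add_lt_add e1 e2) e3.le (by positivity) (by positivity)
end

section
/- Let λ, μ > 0. Then the function w ↦ Δˢ(w) = (μλ/(μ+λ)) · (2w + μ + λ)/((w + μ + λ)(w + μ)(w + λ)) is strictly convex on (0, ∞). -/
theorem aux_amgm (r q : ℝ) (hr : 0 < r) (hq : 0 < q) (h : r + q ≠ 2) :
    3 - r - q < 1 / (r * q) := by
  rw [lt_div_iff₀ (mul_pos hr hq)]
  rcases le_or_gt (3 - r - q) 0 with h0 | h0
  · nlinarith [mul_pos hr hq]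
  · have h1 : (3 - r - q) * (r * q) ≤ (3 - r - q) * ((r + q) / 2) ^ 2 :=
      mul_le_mul_of_nonneg_left (by nlinarith [sq_nonneg (r - q)]) h0.le
    have h2 : 0 < (r + q - 2) ^ 2 * (r + q + 1) :=
      mul_pos (by have := sub_ne_zero.mpr h; positivity) (by positivity)
    nlinarith

theorem aux_tangent (a b x z : ℝ) (ha : 0 < a) (hb : 0 < b) (hx : 0 < x) (hz : 0 < z)
    (h : x ≠ z) :
    1 / ((z + a) * (z + b)) * (1 - (x - z) * (1 / (z + a) + 1 / (z + b)))
      < 1 / ((x + a) * (x + b)) := by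
  have hd : (x + a) / (z + a) + (x + b) / (z + b)
      = 2 + (x - z) * (1 / (z + a) + 1 / (z + b)) := by
    field_simp; ring
  have hk : 0 < 1 / (z + a) + 1 / (z + b) := by positivity
  have := aux_amgm ((x + a) / (z + a)) ((x + b) / (z + b)) (by positivity) (by positivity)
    (by
      rw [hd]; intro h'
      have : (x - z) * (1 / (z + a) + 1 / (z + b)) = 0 := by linarith
      rcases mul_eq_zero.mp this with h1 | h1
      · exact h (sub_eq_zero.mp h1)
      · exact hk.ne' h1)
  have hp : 0 < 1 / ((z + a) * (z + b)) := by positivity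
  have h3 := mul_lt_mul_of_pos_left this hp
  have e : 1 / ((z + a) * (z + b)) * (1 / ((x + a) / (z + a) * ((x + b) / (z + b))))
      = 1 / ((x + a) * (x + b)) := by field_simp
  rw [e] at h3
  have e2 : 3 - (x + a) / (z + a) - (x + b) / (z + b)
      = 1 - (x - z) * (1 / (z + a) + 1 / (z + b)) := by linarith
  rwa [e2] at h3

theorem aux_conv (a b : ℝ) (ha : 0 < a) (hb : 0 < b) :
    StrictConvexOn ℝ (Set.Ioi 0) (fun w : ℝ => 1 / ((w + a) * (w + b))) := by
  refine ⟨convex_Ioi 0, ?_⟩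
  intro x hx y hy hxy s t hs ht hst
  simp only [Set.mem_Ioi, smul_eq_mul] at *
  obtain rfl : s = 1 - t := by linarith
  have hz : 0 < (1 - t) * x + t * y := by positivity
  have hs' := hs.ne'
  have h1 := aux_tangent a b x _ ha hb hx hz (by
    intro h
    have : t * (x - y) = 0 := by linarith
    exact (mul_ne_zero ht.ne' (sub_ne_zero.mpr hxy)) this)
  have h2 := aux_tangent a b y _ ha hb hy hz (by
    intro h
    have : (1 - t) * (x - y) = 0 := by linarith
    exact (mul_ne_zero hs' (sub_ne_zero.mpr hxy)) this)
  have h1' := mul_lt_mul_of_pos_left h1 hs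
  have h2' := mul_lt_mul_of_pos_left h2 ht
  refine lt_of_eq_of_lt ?_ (add_lt_add h1' h2')
  ring

theorem stmt_19 (lam mu : ℝ) (hlam : 0 < lam) (hmu : 0 < mu) :
    StrictConvexOn ℝ (Set.Ioi 0) (fun w : ℝ =>
        (mu * lam / (mu + lam)) * ((2 * w + mu + lam) / ((w + mu + lam) * (w + mu) * (w + lam)))) := by
  have h := (aux_conv (mu + lam) mu (by positivity) hmu).add
    (aux_conv (mu + lam) lam (by positivity) hlam)
  have hc : 0 < mu * lam / (mu + lam) := by positivity
  have key : ∀ w : ℝ, 0 < w → (2 * w + mu + lam) / ((w + mu + lam) * (w + mu) * (w + lam))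
      = 1 / ((w + (mu + lam)) * (w + mu)) + 1 / ((w + (mu + lam)) * (w + lam)) := by
    intro w hw
    rw [← add_assoc w mu lam]
    field_simp
    ring
  refine ⟨convex_Ioi 0, ?_⟩
  intro x hx y hy hxy s t hs ht hst
  have h4 := h.2 hx hy hxy hs ht hst
  simp only [Set.mem_Ioi, smul_eq_mul, Pi.add_apply] at *
  rw [key x hx, key y hy, key (s * x + t * y) (by positivity)]
  have h5 := mul_lt_mul_of_pos_left h4 hc
  refine lt_of_lt_of_eq h5 ?_
  ring
end
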